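/- Fix μ ∈ (0,1), p ∈ (1/2,1), τ ∈ (0,1), and a threshold ratio q ∈ (0,1]. Consider the sequence of crowdfunding games with parameters (n, μ, p, ⌈q·n⌉, τ). There exists N such that for every n ≥ N the game with n agents has exactly one symmetric non-trivial Bayes–Nash equilibrium. -/

import Mathlib

open Finset Filter

/-- Upper tail of the binomial distribution: `P(Bin(m, r) ≥ k)`. -/
noncomputable def binTail (m k : ℕ) (r : ℝ) : ℝ :=
  ∑ j ∈ Finset.Icc k m, (m.choose j : ℝ) * r ^ j * (1 - r) ^ (m - j)

/-- Contribution probability conditional on the high-value state `G`. -/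
noncomputable def rG (p σh σl : ℝ) : ℝ := p * σh + (1 - p) * σl

/-- Contribution probability conditional on the low-value state `B`. -/
noncomputable def rB (p σh σl : ℝ) : ℝ := (1 - p) * σh + p * σl

/-- Posterior probability of state `G` after the high signal `h`. -/
noncomputable def postH (μ p : ℝ) : ℝ := μ * p / (μ * p + (1 - μ) * (1 - p))

/-- Posterior probability of state `G` after the low signal `l`. -/
noncomputable def postL (μ p : ℝ) : ℝ := μ * (1 - p) / (μ * (1 - p) + (1 - μ) * p)

/-- Expected gain from contributing for an agent whose posterior on `G` is `β`,
when each of the other `n - 1` agents plays the symmetric strategy `(σh, σl)`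
and the threshold is `T`. -/
noncomputable def gain (n T : ℕ) (p τ β σh σl : ℝ) : ℝ :=
  β * (1 - τ) * binTail (n - 1) (T - 1) (rG p σh σl)
    - (1 - β) * τ * binTail (n - 1) (T - 1) (rB p σh σl)

/-- `(σh, σl)` is a symmetric Bayes–Nash equilibrium of the crowdfunding game
with parameters `(n, μ, p, T, τ)`. -/
def IsSymmEq (n T : ℕ) (μ p τ σh σl : ℝ) : Prop :=
  0 ≤ σh ∧ σh ≤ 1 ∧ 0 ≤ σl ∧ σl ≤ 1 ∧
  (0 < σh → 0 ≤ gain n T p τ (postH μ p) σh σl) ∧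
  (σh < 1 → gain n T p τ (postH μ p) σh σl ≤ 0) ∧
  (0 < σl → 0 ≤ gain n T p τ (postL μ p) σh σl) ∧
  (σl < 1 → gain n T p τ (postL μ p) σh σl ≤ 0)

/-- The density `d/dr P(Bin(m, r) ≥ k)`. -/
noncomputable def binTailDeriv (m k : ℕ) (r : ℝ) : ℝ :=
  k * (m.choose k : ℝ) * r ^ (k - 1) * (1 - r) ^ (m - k)

/-- The ratio of the success probabilities in the two states. -/
noncomputable def tailRatio (m k : ℕ) (p σh σl : ℝ) : ℝ :=
  binTail m k (rG p σh σl) / binTail m k (rB p σh σl)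

/-- The likelihood ratio above which an agent with posterior `β` contributes. -/
noncomputable def cutoff (τ β : ℝ) : ℝ := (1 - β) * τ / (β * (1 - τ))

lemma binTail_pos {m k : ℕ} (hk : k ≤ m) {r : ℝ} (h0 : 0 < r) (h1 : r ≤ 1) :
    0 < binTail m k r := by
  have h1' : 0 ≤ 1 - r := by linarith
  refine Finset.sum_pos' (fun j _ => by positivity) ⟨m, by simp [hk], ?_⟩
  simpa using pow_pos h0 m

lemma continuous_binTail (m k : ℕ) : Continuous (binTail m k) := by
  unfold binTail
  fun_prop

lemma hasDerivAt_binTail {m k : ℕ} (hk : k ≤ m) (r : ℝ) :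
    HasDerivAt (binTail m k) (binTailDeriv m k r) r := by
  induction hk using Nat.decreasingInduction with
  | self =>
    have : binTail m m = fun r => r ^ m := by
      funext r
      simp [binTail]
    rw [this]
    simpa [binTailDeriv] using hasDerivAt_pow m r
  | of_succ k hk ih =>
    have hrec : binTail m k = fun r =>
        (m.choose k : ℝ) * (r ^ k * (1 - r) ^ (m - k)) + binTail m (k + 1) r := by
      funext r
      simp only [binTail, ← Finset.add_sum_Ioc_eq_sum_Icc hk.le]
      rw [← Finset.Icc_succ_left_eq_Ioc]
      simp [mul_assoc]
    rw [hrec]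
    have h1 : HasDerivAt (fun r : ℝ => (1 - r) ^ (m - k))
        (((m - k : ℕ) : ℝ) * (1 - r) ^ (m - k - 1) * (-1)) r := by
      simpa using ((hasDerivAt_id r).const_sub 1).fun_pow (m - k)
    have h2 := (((hasDerivAt_pow k r).mul h1).const_mul (m.choose k : ℝ)).add ih
    refine h2.congr_deriv ?_
    have hc : (m.choose (k + 1) : ℝ) * ((k : ℝ) + 1) = m.choose k * ((m - k : ℕ) : ℝ) := by
      exact_mod_cast Nat.choose_succ_right_eq m k
    simp only [binTailDeriv, Nat.add_sub_cancel, Nat.sub_sub]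
    push_cast
    linear_combination (r ^ k * (1 - r) ^ (m - (k + 1))) * hc

lemma binTailDeriv_pos {m k : ℕ} (hk : k ≤ m) (hk0 : 0 < k) {r : ℝ} (h0 : 0 < r) (h1 : r < 1) :
    0 < binTailDeriv m k r := by
  have h1' : 0 < 1 - r := by linarith
  have := Nat.choose_pos hk
  unfold binTailDeriv
  positivity

lemma mul_binTailDeriv {m k : ℕ} (hk0 : 0 < k) (r : ℝ) :
    r * binTailDeriv m k r = k * (m.choose k : ℝ) * (r ^ k * (1 - r) ^ (m - k)) := by
  obtain ⟨k, rfl⟩ := Nat.exists_eq_succ_of_ne_zero hk0.ne'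
  simp only [binTailDeriv, Nat.succ_eq_add_one, Nat.add_sub_cancel]
  ring

lemma weight_cross_le {m k j : ℕ} (hkj : k ≤ j) (hjm : j ≤ m) {a b : ℝ}
    (ha : 0 < a) (hab : a < b) (hb : b < 1) :
    b ^ k * (1 - b) ^ (m - k) * (a ^ j * (1 - a) ^ (m - j)) ≤
      a ^ k * (1 - a) ^ (m - k) * (b ^ j * (1 - b) ^ (m - j)) := by
  obtain ⟨i, rfl⟩ := Nat.exists_eq_add_of_le hkj
  obtain ⟨l, rfl⟩ := Nat.exists_eq_add_of_le hjm
  have e1 : k + i + l - k = i + l := by omega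
  have e2 : k + i + l - (k + i) = l := by omega
  rw [e1, e2]
  have h1a : 0 < 1 - a := by linarith
  have h1b : 0 < 1 - b := by linarith
  have hb0 : 0 < b := ha.trans hab
  have h : (a * (1 - b)) ^ i ≤ (b * (1 - a)) ^ i :=
    pow_le_pow_left₀ (by positivity) (by nlinarith) i
  calc b ^ k * (1 - b) ^ (i + l) * (a ^ (k + i) * (1 - a) ^ l)
      = a ^ k * b ^ k * (1 - a) ^ l * (1 - b) ^ l * (a * (1 - b)) ^ i := by
        rw [mul_pow]; ring
    _ ≤ a ^ k * b ^ k * (1 - a) ^ l * (1 - b) ^ l * (b * (1 - a)) ^ i := by gcongr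
    _ = _ := by rw [mul_pow]; ring

lemma weight_cross_lt {m k : ℕ} (hkm : k < m) {a b : ℝ}
    (ha : 0 < a) (hab : a < b) (hb : b < 1) :
    b ^ k * (1 - b) ^ (m - k) * a ^ m < a ^ k * (1 - a) ^ (m - k) * b ^ m := by
  obtain ⟨i, rfl⟩ := Nat.exists_eq_add_of_le hkm.le
  have hi : i ≠ 0 := by omega
  rw [Nat.add_sub_cancel_left]
  have h1b : 0 < 1 - b := by linarith
  have hb0 : 0 < b := ha.trans hab
  have h : (a * (1 - b)) ^ i < (b * (1 - a)) ^ i :=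
    pow_lt_pow_left₀ (by nlinarith) (by positivity) hi
  calc b ^ k * (1 - b) ^ i * a ^ (k + i)
      = a ^ k * b ^ k * (a * (1 - b)) ^ i := by rw [mul_pow]; ring
    _ < a ^ k * b ^ k * (b * (1 - a)) ^ i := by gcongr
    _ = _ := by rw [mul_pow]; ring

/-- The elasticity of the binomial tail is antitone in the success probability. -/
lemma elasticity_le {m k : ℕ} (hk0 : 0 < k) {a b : ℝ}
    (ha : 0 < a) (hab : a < b) (hb : b < 1) :
    b * binTailDeriv m k b * binTail m k a ≤ a * binTailDeriv m k a * binTail m k b := by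
  rw [mul_binTailDeriv hk0, mul_binTailDeriv hk0, mul_assoc (k * _ : ℝ), mul_assoc (k * _ : ℝ)]
  refine mul_le_mul_of_nonneg_left ?_ (by positivity)
  simp only [binTail, Finset.mul_sum]
  refine Finset.sum_le_sum fun j hj => ?_
  rw [Finset.mem_Icc] at hj
  have := mul_le_mul_of_nonneg_left (weight_cross_le hj.1 hj.2 ha hab hb)
    (Nat.cast_nonneg (α := ℝ) (m.choose j))
  linarith

/-- The elasticity of the binomial tail is strictly antitone below the unanimity threshold. -/
lemma elasticity_lt {m k : ℕ} (hk0 : 0 < k) (hkm : k < m) {a b : ℝ}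
    (ha : 0 < a) (hab : a < b) (hb : b < 1) :
    b * binTailDeriv m k b * binTail m k a < a * binTailDeriv m k a * binTail m k b := by
  rw [mul_binTailDeriv hk0, mul_binTailDeriv hk0, mul_assoc (k * _ : ℝ), mul_assoc (k * _ : ℝ)]
  have := Nat.choose_pos hkm.le
  refine mul_lt_mul_of_pos_left ?_ (by positivity)
  simp only [binTail, Finset.mul_sum]
  refine Finset.sum_lt_sum (fun j hj => ?_) ⟨m, by simp [hkm.le], ?_⟩
  · rw [Finset.mem_Icc] at hj
    have := mul_le_mul_of_nonneg_left (weight_cross_le hj.1 hj.2 ha hab hb)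
      (Nat.cast_nonneg (α := ℝ) (m.choose j))
    linarith
  · simpa using weight_cross_lt hkm ha hab hb

/-- The binomial tail is log-concave in the success probability. -/
lemma logDeriv_binTail_le {m k : ℕ} (hk : k ≤ m) (hk0 : 0 < k) {a b : ℝ}
    (ha : 0 < a) (hab : a < b) (hb : b < 1) :
    binTailDeriv m k b * binTail m k a ≤ binTailDeriv m k a * binTail m k b := by
  have h := elasticity_le (m := m) hk0 ha hab hb
  have hd := binTailDeriv_pos hk hk0 ha (hab.trans hb)
  have hF := binTail_pos hk (ha.trans hab) hb.le
  have := mul_pos hd hF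
  by_contra! hlt
  nlinarith [mul_lt_mul_of_pos_left hlt (ha.trans hab)]

lemma tailRatio_high_strictAntiOn {m k : ℕ} (hk0 : 0 < k) (hkm : k < m) {p : ℝ}
    (hp : 1 / 2 < p) (hp1 : p < 1) :
    StrictAntiOn (fun x => tailRatio m k p x 0) (Set.Ioc 0 1) := by
  have hB : ∀ x ∈ Set.Ioc (0 : ℝ) 1, 0 < binTail m k ((1 - p) * x) := fun x hx =>
    binTail_pos hkm.le (mul_pos (by linarith) hx.1) (by nlinarith [hx.1, hx.2])
  simp only [tailRatio, rG, rB, mul_zero, add_zero]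
  refine strictAntiOn_of_deriv_neg (convex_Ioc 0 1) ?_ fun x hx => ?_
  · exact ContinuousOn.div ((continuous_binTail m k).comp (by fun_prop)).continuousOn
      ((continuous_binTail m k).comp (by fun_prop)).continuousOn fun x hx => (hB x hx).ne'
  · rw [interior_Ioc] at hx
    have hpos := hB x ⟨hx.1, hx.2.le⟩
    have hc (c : ℝ) : HasDerivAt (fun x => c * x) c x := by
      simpa using (hasDerivAt_id x).const_mul c
    have h1 := (hasDerivAt_binTail hkm.le (p * x)).comp x (hc p)
    have h2 := (hasDerivAt_binTail hkm.le ((1 - p) * x)).comp x (hc (1 - p))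
    have hd := h1.div h2 hpos.ne'
    erw [hd.deriv]
    refine div_neg_of_neg_of_pos ?_ (pow_pos hpos 2)
    have he := elasticity_lt hk0 hkm (a := (1 - p) * x) (b := p * x)
      (mul_pos (by linarith) hx.1) (by nlinarith [hx.1]) (by nlinarith [hx.1, hx.2])
    have hx0 := hx.1
    simp only [Function.comp]
    by_contra! hge
    nlinarith [mul_nonneg hx0.le hge]

lemma tailRatio_low_strictAntiOn {m k : ℕ} (hk : k ≤ m) (hk0 : 0 < k) {p : ℝ}
    (hp : 1 / 2 < p) (hp1 : p < 1) :
    StrictAntiOn (fun y => tailRatio m k p 1 y) (Set.Icc 0 1) := by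
  have hB : ∀ y ∈ Set.Icc (0 : ℝ) 1, 0 < binTail m k ((1 - p) + p * y) := fun y hy =>
    binTail_pos hk (by nlinarith [hy.1]) (by nlinarith [hy.2])
  simp only [tailRatio, rG, rB, mul_one]
  refine strictAntiOn_of_deriv_neg (convex_Icc 0 1) ?_ fun y hy => ?_
  · exact ContinuousOn.div ((continuous_binTail m k).comp (by fun_prop)).continuousOn
      ((continuous_binTail m k).comp (by fun_prop)).continuousOn fun y hy => (hB y hy).ne'
  · rw [interior_Icc] at hy
    have hpos := hB y ⟨hy.1.le, hy.2.le⟩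
    have hc (c d : ℝ) : HasDerivAt (fun y => d + c * y) c y := by
      simpa using ((hasDerivAt_id y).const_mul c).const_add d
    have h1 := (hasDerivAt_binTail hk (p + (1 - p) * y)).comp y (hc (1 - p) p)
    have h2 := (hasDerivAt_binTail hk ((1 - p) + p * y)).comp y (hc p (1 - p))
    have hd := h1.div h2 hpos.ne'
    erw [hd.deriv]
    refine div_neg_of_neg_of_pos ?_ (pow_pos hpos 2)
    have ha : 0 < (1 - p) + p * y := by nlinarith [hy.1]
    have hab : (1 - p) + p * y < p + (1 - p) * y := by nlinarith [hy.2]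
    have hb : p + (1 - p) * y < 1 := by nlinarith [hy.2]
    have he := logDeriv_binTail_le hk hk0 ha hab hb
    have hpos' := mul_pos (binTailDeriv_pos hk hk0 ha (hab.trans hb))
      (binTail_pos hk (ha.trans hab) hb.le)
    simp only [Function.comp]
    nlinarith [mul_le_mul_of_nonneg_left he (show 0 ≤ 1 - p by linarith)]

lemma tailRatio_unanimous {m : ℕ} {p x : ℝ} (hx : 0 < x) :
    tailRatio m m p x 0 = (p / (1 - p)) ^ m := by
  simp only [tailRatio, rG, rB, binTail, Finset.Icc_self, Finset.sum_singleton]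
  simp only [mul_zero, add_zero, Nat.choose_self, Nat.cast_one, one_mul, Nat.sub_self, pow_zero,
    mul_one]
  rw [← div_pow, mul_div_mul_right _ _ hx.ne']

lemma exists_lt_tailRatio {m k : ℕ} (hk : k ≤ m) {p c : ℝ} (hp1 : p < 1)
    (hc : c < (p / (1 - p)) ^ k) :
    ∃ x ∈ Set.Ioo (0 : ℝ) 1, c < tailRatio m k p x 0 := by
  let Q : ℝ → ℝ := fun r => ∑ j ∈ Finset.Icc k m, (m.choose j : ℝ) * r ^ (j - k) * (1 - r) ^ (m - j)
  have hQ : Continuous Q := by fun_prop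
  have hfac (r : ℝ) : binTail m k r = r ^ k * Q r := by
    simp only [binTail, Q, Finset.mul_sum]
    refine Finset.sum_congr rfl fun j hj => ?_
    rw [← Nat.add_sub_of_le (Finset.mem_Icc.mp hj).1, pow_add, Nat.add_sub_cancel_left]
    ring
  have hQ0 : Q 0 = m.choose k := by
    simp only [Q]
    rw [Finset.sum_eq_single_of_mem k (by simp [hk])]
    · simp
    · intro j hj hjk
      have : j - k ≠ 0 := by have := (Finset.mem_Icc.mp hj).1; omega
      simp [this]
  have hch : (0 : ℝ) < m.choose k := by exact_mod_cast Nat.choose_pos hk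
  have hcont : ContinuousAt (fun x => (p / (1 - p)) ^ k * (Q (p * x) / Q ((1 - p) * x))) 0 := by
    refine continuousAt_const.mul (ContinuousAt.div ?_ ?_ ?_)
    · exact (hQ.comp (by fun_prop)).continuousAt
    · exact (hQ.comp (by fun_prop)).continuousAt
    · simp [hQ0, hch.ne']
  have hev := hcont.eventually (lt_mem_nhds (a := c) (by simpa [hQ0, hch.ne'] using hc))
  have hev' := (hev.filter_mono nhdsWithin_le_nhds).and
    (Ioo_mem_nhdsGT (zero_lt_one (α := ℝ)))
  obtain ⟨x, hx, hx1⟩ := hev'.exists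
  refine ⟨x, hx1, hx.trans_eq ?_⟩
  have hp' : 1 - p ≠ 0 := by linarith
  have hx0 : x ≠ 0 := hx1.1.ne'
  simp only [tailRatio, rG, rB, mul_zero, add_zero, hfac]
  rw [mul_div_mul_comm, ← div_pow, mul_div_mul_right _ _ hx0]

lemma rB_mem_Ioc {p σh σl : ℝ} (hp : 0 < p) (hp1 : p < 1) (h0 : 0 ≤ σh) (h1 : σh ≤ 1)
    (l0 : 0 ≤ σl) (l1 : σl ≤ 1) (hne : 0 < σh ∨ 0 < σl) :
    rB p σh σl ∈ Set.Ioc 0 1 := by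
  have hq : 0 < 1 - p := by linarith
  unfold rB
  refine ⟨?_, by nlinarith⟩
  rcases hne with h | h <;> positivity

lemma gain_eq {n T : ℕ} {p τ β σh σl : ℝ} (hβ : 0 < β) (hτ : τ < 1)
    (hB : 0 < binTail (n - 1) (T - 1) (rB p σh σl)) :
    gain n T p τ β σh σl = β * (1 - τ) * binTail (n - 1) (T - 1) (rB p σh σl) *
      (tailRatio (n - 1) (T - 1) p σh σl - cutoff τ β) := by
  have : 1 - τ ≠ 0 := by linarith
  unfold gain tailRatio cutoff
  field_simp

lemma gain_nonneg_iff {n T : ℕ} {p τ β σh σl : ℝ} (hβ : 0 < β) (hτ : τ < 1)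
    (hB : 0 < binTail (n - 1) (T - 1) (rB p σh σl)) :
    0 ≤ gain n T p τ β σh σl ↔ cutoff τ β ≤ tailRatio (n - 1) (T - 1) p σh σl := by
  have : 0 < 1 - τ := by linarith
  rw [gain_eq hβ hτ hB, mul_nonneg_iff_of_pos_left (by positivity), sub_nonneg]

lemma gain_nonpos_iff {n T : ℕ} {p τ β σh σl : ℝ} (hβ : 0 < β) (hτ : τ < 1)
    (hB : 0 < binTail (n - 1) (T - 1) (rB p σh σl)) :
    gain n T p τ β σh σl ≤ 0 ↔ tailRatio (n - 1) (T - 1) p σh σl ≤ cutoff τ β := by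
  have : 0 < 1 - τ := by linarith
  rw [gain_eq hβ hτ hB, ← sub_nonpos (b := cutoff τ β)]
  exact mul_nonpos_iff_pos_imp_nonpos.trans
    ⟨fun h => h.1 (by positivity), fun h => ⟨fun _ => h, fun _ => by positivity⟩⟩

lemma isSymmEq_iff {n T : ℕ} {μ p τ σh σl : ℝ} (hT : T - 1 ≤ n - 1)
    (hp : 0 < p) (hp1 : p < 1) (hτ : τ < 1)
    (hH : 0 < postH μ p) (hL : 0 < postL μ p)
    (hσ : σh ∈ Set.Icc 0 1 ∧ σl ∈ Set.Icc 0 1) (hne : 0 < σh ∨ 0 < σl) :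
    IsSymmEq n T μ p τ σh σl ↔
      (0 < σh → cutoff τ (postH μ p) ≤ tailRatio (n - 1) (T - 1) p σh σl) ∧
      (σh < 1 → tailRatio (n - 1) (T - 1) p σh σl ≤ cutoff τ (postH μ p)) ∧
      (0 < σl → cutoff τ (postL μ p) ≤ tailRatio (n - 1) (T - 1) p σh σl) ∧
      (σl < 1 → tailRatio (n - 1) (T - 1) p σh σl ≤ cutoff τ (postL μ p)) := by
  obtain ⟨⟨h0, h1⟩, l0, l1⟩ := hσ
  have hr := rB_mem_Ioc hp hp1 h0 h1 l0 l1 hne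
  have hB := binTail_pos hT hr.1 hr.2
  simp only [IsSymmEq, h0, h1, l0, l1, true_and, gain_nonneg_iff hH hτ hB,
    gain_nonneg_iff hL hτ hB, gain_nonpos_iff hH hτ hB, gain_nonpos_iff hL hτ hB]

/-- Single crossing along the path from `(0, 0)` through `(1, 0)` to `(1, 1)` yields a unique
profile satisfying the best-response conditions. -/
lemma existsUnique_of_single_crossing {R : ℝ → ℝ → ℝ} {ch cl : ℝ} (hc : ch < cl)
    (hch : ContinuousOn (fun x => R x 0) (Set.Ioc 0 1))
    (hcl : ContinuousOn (fun y => R 1 y) (Set.Icc 0 1))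
    (hsmall : ∃ x ∈ Set.Ioo (0 : ℝ) 1, ch < R x 0)
    (hhigh : ∀ x x', 0 < x → x < x' → x' ≤ 1 → ch ≤ R x' 0 → ch < R x 0)
    (hlow : StrictAntiOn (fun y => R 1 y) (Set.Icc 0 1)) :
    ∃! σ : ℝ × ℝ, (σ.1 ∈ Set.Icc 0 1 ∧ σ.2 ∈ Set.Icc 0 1) ∧ (0 < σ.1 ∨ 0 < σ.2) ∧
      (0 < σ.1 → ch ≤ R σ.1 σ.2) ∧ (σ.1 < 1 → R σ.1 σ.2 ≤ ch) ∧
      (0 < σ.2 → cl ≤ R σ.1 σ.2) ∧ (σ.2 < 1 → R σ.1 σ.2 ≤ cl) := by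
  refine existsUnique_of_exists_of_unique ?_ ?_
  · obtain ⟨x₀, ⟨hx0, hx1⟩, hx⟩ := hsmall
    rcases lt_or_ge (R 1 0) ch with h1 | h1
    · have hcont := hch.mono (fun z (hz : z ∈ Set.Icc x₀ 1) => ⟨hx0.trans_le hz.1, hz.2⟩)
      obtain ⟨x, hxm, hxe⟩ := intermediate_value_Icc' hx1.le hcont ⟨h1.le, hx.le⟩
      have hx' : 0 < x := hx0.trans_le hxm.1
      simp only at hxe
      exact ⟨(x, 0), ⟨⟨hx'.le, hxm.2⟩, by simp⟩, Or.inl hx', fun _ => hxe.ge, fun _ => hxe.le,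
        fun h => absurd h (lt_irrefl _), fun _ => hxe.le.trans hc.le⟩
    rcases le_or_gt (R 1 0) cl with h2 | h2
    · exact ⟨(1, 0), by simp, by simp, fun _ => h1, fun h => absurd h (lt_irrefl _),
        fun h => absurd h (lt_irrefl _), fun _ => h2⟩
    rcases le_or_gt cl (R 1 1) with h3 | h3
    · exact ⟨(1, 1), by simp, by simp, fun _ => hc.le.trans h3, fun h => absurd h (lt_irrefl _),
        fun _ => h3, fun h => absurd h (lt_irrefl _)⟩
    · obtain ⟨y, hy, hye⟩ := intermediate_value_Icc' zero_le_one hcl ⟨h3.le, h2.le⟩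
      simp only at hye
      exact ⟨(1, y), ⟨by simp, hy⟩, by simp, fun _ => hc.le.trans hye.ge,
        fun h => absurd h (lt_irrefl _), fun _ => hye.ge, fun _ => hye.le⟩
  · have key : ∀ x y : ℝ, (x ∈ Set.Icc (0 : ℝ) 1 ∧ y ∈ Set.Icc (0 : ℝ) 1) → (0 < x ∨ 0 < y) →
        (x < 1 → R x y ≤ ch) → (0 < y → cl ≤ R x y) → x = 1 ∨ (y = 0 ∧ 0 < x ∧ x < 1) := by
      rintro x y ⟨hx, hy⟩ hne h2 h3
      rcases hx.2.eq_or_lt with h | h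
      · exact Or.inl h
      have hy0 : ¬ 0 < y := fun h' => by linarith [h2 h, h3 h']
      exact Or.inr ⟨le_antisymm (not_lt.mp hy0) hy.1, hne.resolve_right hy0, h⟩
    have lowUniq : ∀ y z : ℝ, y ∈ Set.Icc (0 : ℝ) 1 → z ∈ Set.Icc (0 : ℝ) 1 → y < z →
        (y < 1 → R 1 y ≤ cl) → (0 < z → cl ≤ R 1 z) → False := by
      intro y z hy hz hyz h1 h2
      have := hlow hy hz hyz
      simp only at this
      linarith [h1 (hyz.trans_le hz.2), h2 (hy.1.trans_lt hyz)]
    have mixed : ∀ x y : ℝ, 0 < x → x < 1 → R x 0 ≤ ch → y ∈ Set.Icc (0 : ℝ) 1 →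
        ch ≤ R 1 y → False := by
      intro x y hx hx1 h1 hy h2
      have : R 1 y ≤ R 1 0 := hlow.antitoneOn (by simp) hy hy.1
      linarith [hhigh x 1 hx hx1 le_rfl (h2.trans this)]
    rintro ⟨x, y⟩ ⟨x', y'⟩ ⟨hm, hne, h1, h2, h3, h4⟩ ⟨hm', hne', h1', h2', h3', h4'⟩
    simp only at hm hne h1 h2 h3 h4 hm' hne' h1' h2' h3' h4'
    rcases key x y hm hne h2 h3 with rfl | ⟨rfl, hx, hx1⟩ <;>
      rcases key x' y' hm' hne' h2' h3' with rfl | ⟨rfl, hx', hx1'⟩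
    · rcases lt_trichotomy y y' with h | rfl | h
      · exact (lowUniq y y' hm.2 hm'.2 h h4 h3').elim
      · rfl
      · exact (lowUniq y' y hm'.2 hm.2 h h4' h3).elim
    · exact (mixed x' y hx' hx1' (h2' hx1') hm.2 (h1 one_pos)).elim
    · exact (mixed x y' hx hx1 (h2 hx1) hm'.2 (h1' one_pos)).elim
    · rcases lt_trichotomy x x' with h | rfl | h
      · linarith [hhigh x x' hx h hx1'.le (h1' hx'), h2 hx1]
      · rfl
      · linarith [hhigh x' x hx' h hx1.le (h1 hx), h2' hx1']

lemma continuousOn_tailRatio {m k : ℕ} (hk : k ≤ m) {p : ℝ} (hp : 0 < p) (hp1 : p < 1) :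
    ContinuousOn (fun σ : ℝ × ℝ => tailRatio m k p σ.1 σ.2)
      {σ | (σ.1 ∈ Set.Icc 0 1 ∧ σ.2 ∈ Set.Icc 0 1) ∧ (0 < σ.1 ∨ 0 < σ.2)} := by
  unfold tailRatio
  refine ContinuousOn.div ?_ ?_ ?_
  · exact ((continuous_binTail m k).comp (by unfold rG; fun_prop)).continuousOn
  · exact ((continuous_binTail m k).comp (by unfold rB; fun_prop)).continuousOn
  · rintro σ ⟨⟨h, l⟩, hne⟩
    have hr := rB_mem_Ioc hp hp1 h.1 h.2 l.1 l.2 hne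
    exact (binTail_pos hk hr.1 hr.2).ne'

lemma postL_pos {μ p : ℝ} (hμ : 0 < μ) (hμ1 : μ < 1) (hp : 0 < p) (hp1 : p < 1) :
    0 < postL μ p := by
  have : 0 < 1 - μ := by linarith
  have : 0 < 1 - p := by linarith
  unfold postL
  positivity

lemma postL_lt_postH {μ p : ℝ} (hμ : 0 < μ) (hμ1 : μ < 1) (hp : 1 / 2 < p) (hp1 : p < 1) :
    postL μ p < postH μ p := by
  have h1 : 0 < 1 - μ := by linarith
  have h2 : 0 < 1 - p := by linarith
  have h3 : 0 < p := by linarith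
  unfold postL postH
  rw [div_lt_div_iff₀ (by positivity) (by positivity)]
  have h4 : 0 < μ * (1 - μ) := by positivity
  nlinarith

lemma cutoff_lt_cutoff {τ a b : ℝ} (hτ : 0 < τ) (hτ1 : τ < 1) (ha : 0 < a) (hab : a < b) :
    cutoff τ b < cutoff τ a := by
  have h1 : 0 < 1 - τ := by linarith
  have hb : 0 < b := ha.trans hab
  unfold cutoff
  rw [div_lt_div_iff₀ (by positivity) (by positivity)]
  nlinarith [mul_pos hτ h1]

/-- A threshold that is large enough, relative to the high-signal cutoff, forces uniqueness. -/
lemma existsUnique_isSymmEq {n T : ℕ} {μ p τ : ℝ} (hμ : 0 < μ ∧ μ < 1)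
    (hp : 1 / 2 < p ∧ p < 1) (hτ : 0 < τ ∧ τ < 1) (hT : T ≤ n) (hT1 : 1 < T)
    (hlarge : cutoff τ (postH μ p) < (p / (1 - p)) ^ (T - 1)) :
    ∃! σ : ℝ × ℝ, IsSymmEq n T μ p τ σ.1 σ.2 ∧ (0 < σ.1 ∨ 0 < σ.2) := by
  have hk : T - 1 ≤ n - 1 := by omega
  have hk0 : 0 < T - 1 := by omega
  have hp0 : 0 < p := by linarith [hp.1]
  have hL := postL_pos hμ.1 hμ.2 hp0 hp.2
  have hLH := postL_lt_postH hμ.1 hμ.2 hp.1 hp.2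
  have hcont := continuousOn_tailRatio hk hp0 hp.2
  have huniq := existsUnique_of_single_crossing (R := tailRatio (n - 1) (T - 1) p)
    (cutoff_lt_cutoff hτ.1 hτ.2 hL hLH)
    (hcont.comp (f := fun x : ℝ => (x, (0 : ℝ))) (by fun_prop)
      fun x hx => ⟨⟨⟨hx.1.le, hx.2⟩, by simp⟩, Or.inl hx.1⟩)
    (hcont.comp (f := fun y : ℝ => ((1 : ℝ), y)) (by fun_prop)
      fun y hy => ⟨⟨by simp, hy⟩, Or.inl one_pos⟩)
    (exists_lt_tailRatio hk hp.2 hlarge)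
    (by
      intro x x' hx hxx' hx' h
      rcases hk.lt_or_eq with hlt | heq
      · exact h.trans_lt (tailRatio_high_strictAntiOn hk0 hlt hp.1 hp.2
          ⟨hx, hxx'.le.trans hx'⟩ ⟨hx.trans hxx', hx'⟩ hxx')
      · rw [← heq, tailRatio_unanimous hx]
        exact hlarge)
    (tailRatio_low_strictAntiOn hk hk0 hp.1 hp.2)
  refine (existsUnique_congr fun σ => ?_).mpr huniq
  constructor
  · rintro ⟨h, hne⟩
    have hσ : σ.1 ∈ Set.Icc (0 : ℝ) 1 ∧ σ.2 ∈ Set.Icc (0 : ℝ) 1 :=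
      ⟨⟨h.1, h.2.1⟩, h.2.2.1, h.2.2.2.1⟩
    exact ⟨hσ, hne, (isSymmEq_iff hk hp0 hp.2 hτ.2 (hL.trans hLH) hL hσ hne).mp h⟩
  · rintro ⟨hσ, hne, h⟩
    exact ⟨(isSymmEq_iff hk hp0 hp.2 hτ.2 (hL.trans hLH) hL hσ hne).mpr h, hne⟩

/-- AKS Theorem 1, existence part: for a fixed threshold ratio
`q ∈ (0,1]`, when the population is sufficiently large the crowdfunding game with
threshold `⌈q·n⌉` has exactly one symmetric non-trivial Bayes–Nash equilibrium. -/
theorem unique_symmetric_nontrivial_equilibrium_large_population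
    (μ p τ q : ℝ)
    (hμ : 0 < μ ∧ μ < 1) (hp : 1 / 2 < p ∧ p < 1) (hτ : 0 < τ ∧ τ < 1)
    (hq : 0 < q ∧ q ≤ 1) :
    ∃ N : ℕ, ∀ n : ℕ, N ≤ n →
      ∃! σ : ℝ × ℝ,
        IsSymmEq n ⌈q * (n : ℝ)⌉₊ μ p τ σ.1 σ.2 ∧ (0 < σ.1 ∨ 0 < σ.2) := by
  have hbase : 1 < p / (1 - p) := by
    rw [lt_div_iff₀ (by linarith)]
    linarith
  have hceil : Tendsto (fun n : ℕ => ⌈q * (n : ℝ)⌉₊) atTop atTop :=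
    tendsto_nat_ceil_atTop.comp (tendsto_natCast_atTop_atTop.const_mul_atTop hq.1)
  have hpow : Tendsto (fun n : ℕ => (p / (1 - p)) ^ (⌈q * (n : ℝ)⌉₊ - 1)) atTop atTop :=
    (tendsto_pow_atTop_atTop_of_one_lt hbase).comp ((tendsto_sub_atTop_nat 1).comp hceil)
  obtain ⟨N, hN⟩ := eventually_atTop.mp
    ((hceil.eventually_gt_atTop 1).and (hpow.eventually_gt_atTop (cutoff τ (postH μ p))))
  refine ⟨N, fun n hn => existsUnique_isSymmEq hμ hp hτ ?_ (hN n hn).1 (hN n hn).2⟩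
  exact Nat.ceil_le.mpr (mul_le_of_le_one_left (Nat.cast_nonneg n) hq.2)
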